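/- Let E be a finite-dimensional real inner product space and Φ ⊆ E \ {0} a finite crystallographic root system (possibly non-reduced). Suppose V ⊆ span_ℝ(Φ) is a 2-small subspace, α ∈ Φ ∩ V, β, γ ∈ Φ \ V, the three roots α, β, γ are linearly independent, and (ℝα + ℝβ + ℝγ) ∩ V is two-dimensional. Then there exists an irreducible saturated root subsystem Ψ ⊆ Φ of rank 2 with α ∈ Ψ such that β, γ ∉ Ψ and both intersections (span_ℝ(Ψ) + ℝβ) ∩ V and (span_ℝ(Ψ) + ℝγ) ∩ V are one-dimensional, hence equal to ℝα. -/

import Mathlib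

open scoped RealInnerProductSpace

variable {E : Type*} [NormedAddCommGroup E] [InnerProductSpace ℝ E]

/-- The reflection of `x` in the hyperplane orthogonal to `α`. -/
noncomputable def rootReflection (α x : E) : E :=
  x - (2 * ⟪x, α⟫ / ⟪α, α⟫) • α

/-- `Φ` is a (possibly non-reduced) crystallographic root system in `E`. -/
structure IsRootSystem (Φ : Set E) : Prop where
  finite : Φ.Finite
  ne_zero : ∀ α ∈ Φ, α ≠ 0
  crystallographic : ∀ α ∈ Φ, ∀ β ∈ Φ, ∃ n : ℤ, 2 * ⟪β, α⟫ / ⟪α, α⟫ = (n : ℝ)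
  reflect_mem : ∀ α ∈ Φ, ∀ β ∈ Φ, rootReflection α β ∈ Φ

/-- Two roots of `Φ` are related if they both belong to `Φ` and are non-orthogonal. -/
def chainRel (Φ : Set E) (a b : E) : Prop := a ∈ Φ ∧ b ∈ Φ ∧ ⟪a, b⟫ ≠ 0

/-- The irreducible component of `Φ` containing the root `α`: the set of roots connected to `α`
by a chain of pairwise non-orthogonal roots. -/
def component (Φ : Set E) (α : E) : Set E := {β | Relation.TransGen (chainRel Φ) α β}

/-- A subspace `V ≤ span ℝ Φ` is `k`-small if for every irreducible component `Ψ` of `Φ`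
the codimension of `V ∩ span ℝ Ψ` in `span ℝ Ψ` is at least `k`. -/
def IsSmall (Φ : Set E) (V : Submodule ℝ E) (k : ℕ) : Prop :=
  ∀ α ∈ Φ,
    Module.finrank ℝ ↥(V ⊓ Submodule.span ℝ (component Φ α)) + k ≤
      Module.finrank ℝ ↥(Submodule.span ℝ (component Φ α))

/-- A saturated root subsystem of `Φ`: the intersection of `Φ` with a linear subspace. -/
def IsSaturatedSubsystem (Φ Ψ : Set E) : Prop :=
  ∃ U : Submodule ℝ E, Ψ = Φ ∩ ↑U

/-- A set of roots is irreducible if it is nonempty and any two of its roots are joined by a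
chain of pairwise non-orthogonal roots inside it. -/
def IsIrreducibleSubsystem (Ψ : Set E) : Prop :=
  Ψ.Nonempty ∧ ∀ a ∈ Ψ, ∀ b ∈ Ψ, Relation.TransGen (chainRel Ψ) a b

/-- The rank of a set of roots: the dimension of its real span. -/
noncomputable def rootRank (Ψ : Set E) : ℕ :=
  Module.finrank ℝ ↥(Submodule.span ℝ Ψ)

/-- Every root in the component of `α` is non-orthogonal to some root non-orthogonal to `α`. -/
theorem exists_mem_inner_ne_zero_of_mem_component {Φ : Set E} (hΦ : IsRootSystem Φ) {α δ : E}
    (hα : α ∈ Φ) (hδ : δ ∈ component Φ α) :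
    ∃ ε ∈ Φ, ⟪ε, α⟫ ≠ 0 ∧ ⟪ε, δ⟫ ≠ 0 := by
  have hαα : ⟪α, α⟫ ≠ 0 := inner_self_ne_zero.2 (hΦ.ne_zero α hα)
  induction hδ with
  | single h => exact ⟨α, hα, hαα, h.2.2⟩
  | @tail b c _ h ih =>
    obtain ⟨hb, -, hbc⟩ := h
    obtain ⟨ε, hε, hεα, hεb⟩ := ih
    by_cases hbα : ⟪b, α⟫ = 0
    · by_cases hεc : ⟪ε, c⟫ = 0
      · refine ⟨rootReflection b ε, hΦ.reflect_mem b hb ε hε, ?_, ?_⟩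
        · simpa [rootReflection, inner_sub_left, inner_smul_left, hbα] using hεα
        · simp [rootReflection, inner_sub_left, inner_smul_left, hεc, hεb, hbc, hΦ.ne_zero b hb]
      · exact ⟨ε, hε, hεα, hεc⟩
    · exact ⟨b, hb, hbα, hbc⟩

/-- A subspace containing all roots non-orthogonal to `α` contains the component of `α`. -/
theorem component_subset_of_forall_inner_ne_zero {Φ : Set E} (hΦ : IsRootSystem Φ) {α : E}
    (hα : α ∈ Φ) {U : Submodule ℝ E} (hU : ∀ δ ∈ Φ, ⟪δ, α⟫ ≠ 0 → δ ∈ U) :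
    component Φ α ⊆ U := by
  intro δ hδ
  have hδΦ : δ ∈ Φ := by
    rcases Relation.TransGen.tail'_iff.1 hδ with ⟨b, -, h⟩
    exact h.2.1
  obtain ⟨ε, hε, hεα, hεδ⟩ := exists_mem_inner_ne_zero_of_mem_component hΦ hα hδ
  by_cases hδα : ⟪δ, α⟫ = 0
  · have h1 : rootReflection δ ε ∈ U := by
      refine hU _ (hΦ.reflect_mem δ hδΦ ε hε) ?_
      simpa [rootReflection, inner_sub_left, inner_smul_left, hδα] using hεα
    have h2 := U.sub_mem (hU ε hε hεα) h1
    rw [rootReflection, sub_sub_cancel] at h2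
    refine (U.smul_mem_iff ?_).1 h2
    simp [hεδ, hΦ.ne_zero δ hδΦ]
  · exact hU δ hδΦ hδα

/-- The roots in the plane spanned by two non-orthogonal roots form an irreducible set. -/
theorem isIrreducibleSubsystem_inter_span_pair {Φ : Set E} (hΦ : IsRootSystem Φ) {α δ : E}
    (hα : α ∈ Φ) (hδ : δ ∈ Φ) (hδα : ⟪δ, α⟫ ≠ 0) :
    IsIrreducibleSubsystem (Φ ∩ (Submodule.span ℝ {α, δ} : Submodule ℝ E)) := by
  set Ψ : Set E := Φ ∩ (Submodule.span ℝ {α, δ} : Submodule ℝ E)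
  have hαΨ : α ∈ Ψ := ⟨hα, Submodule.subset_span (by simp)⟩
  have hδΨ : δ ∈ Ψ := ⟨hδ, Submodule.subset_span (by simp)⟩
  have hsymm : ∀ {a b : E}, chainRel Ψ a b → chainRel Ψ b a :=
    fun h => ⟨h.2.1, h.1, by rw [real_inner_comm]; exact h.2.2⟩
  have key : ∀ a ∈ Ψ, Relation.TransGen (chainRel Ψ) a α := by
    intro a ha
    by_cases haα : ⟪a, α⟫ = 0
    · by_cases haδ : ⟪a, δ⟫ = 0
      · obtain ⟨x, y, hxy⟩ := Submodule.mem_span_pair.1 ha.2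
        refine absurd ?_ (hΦ.ne_zero a ha.1)
        rw [← inner_self_eq_zero (𝕜 := ℝ)]
        nth_rewrite 2 [← hxy]
        simp [inner_add_right, inner_smul_right, haα, haδ]
      · exact (Relation.TransGen.single ⟨ha, hδΨ, haδ⟩).tail ⟨hδΨ, hαΨ, hδα⟩
    · exact .single ⟨ha, hαΨ, haα⟩
  refine ⟨⟨α, hαΨ⟩, fun a ha b hb => (key a ha).trans ?_⟩
  have : Std.Symm (chainRel Ψ) := ⟨fun _ _ => hsymm⟩
  exact symm (key b hb)

/-- Enlarging a `2`-small subspace by a line leaves out some root non-orthogonal to `α`. -/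
theorem exists_inner_ne_zero_notMem_sup_span_singleton [FiniteDimensional ℝ E] {Φ : Set E}
    (hΦ : IsRootSystem Φ) {V : Submodule ℝ E} (hsmall : IsSmall Φ V 2) {α : E} (hα : α ∈ Φ)
    (β : E) : ∃ δ ∈ Φ, ⟪δ, α⟫ ≠ 0 ∧ δ ∉ V ⊔ Submodule.span ℝ {β} := by
  by_contra! hcon
  have hle : Submodule.span ℝ (component Φ α) ≤ V ⊔ Submodule.span ℝ {β} :=
    Submodule.span_le.2 (component_subset_of_forall_inner_ne_zero hΦ hα hcon)
  have h1 := hsmall α hα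
  have h2 := Submodule.finrank_sup_add_finrank_inf_eq V (Submodule.span ℝ (component Φ α))
  have h3 := Submodule.finrank_mono (sup_le le_sup_left hle)
  have h4 := Submodule.finrank_add_le_finrank_add_finrank V (Submodule.span ℝ {β})
  have h5 : Module.finrank ℝ (Submodule.span ℝ {β}) ≤ 1 := by
    simpa using finrank_span_le_card (R := ℝ) ({β} : Set E)
  omega

theorem notMem_span_pair_of_notMem_sup {V : Submodule ℝ E} {α β δ : E} (hα : α ∈ V)
    (hβ : β ∉ V) (hδ : δ ∉ V ⊔ Submodule.span ℝ {β}) : β ∉ Submodule.span ℝ {α, δ} := by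
  intro h
  obtain ⟨x, y, hxy⟩ := Submodule.mem_span_pair.1 h
  by_cases hy : y = 0
  · subst hy
    exact hβ (by simpa [← hxy] using V.smul_mem x hα)
  · refine hδ ((Submodule.smul_mem_iff _ hy).1 ?_)
    rw [eq_sub_of_add_eq' hxy]
    exact sub_mem (Submodule.mem_sup_right (Submodule.mem_span_singleton_self β))
      (Submodule.mem_sup_left (V.smul_mem x hα))

theorem span_pair_sup_span_singleton_inf_eq {V : Submodule ℝ E} {α β δ : E} (hα : α ∈ V)
    (hβ : β ∉ V) (hδ : δ ∉ V ⊔ Submodule.span ℝ {β}) :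
    (Submodule.span ℝ {α, δ} ⊔ Submodule.span ℝ {β}) ⊓ V = Submodule.span ℝ {α} := by
  apply le_antisymm
  · rintro v ⟨hv, hvV⟩
    obtain ⟨u, hu, w, hw, rfl⟩ := Submodule.mem_sup.1 hv
    obtain ⟨x, y, rfl⟩ := Submodule.mem_span_pair.1 hu
    obtain ⟨z, rfl⟩ := Submodule.mem_span_singleton.1 hw
    have hy : y = 0 := by
      by_contra hy
      refine hδ ((Submodule.smul_mem_iff _ hy).1 ?_)
      have h : y • δ = (x • α + y • δ + z • β - x • α) - z • β := by abel
      rw [h]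
      exact sub_mem (Submodule.mem_sup_left (sub_mem hvV (V.smul_mem x hα)))
        (Submodule.mem_sup_right (Submodule.smul_mem _ z (Submodule.mem_span_singleton_self β)))
    subst hy
    have hz : z = 0 := by
      by_contra hz
      refine hβ ((V.smul_mem_iff hz).1 ?_)
      have h : z • β = (x • α + (0 : ℝ) • δ + z • β) - x • α := by simp
      rw [h]
      exact sub_mem hvV (V.smul_mem x hα)
    subst hz
    simpa using Submodule.smul_mem _ x (Submodule.mem_span_singleton_self α)
  · rw [Submodule.span_singleton_le_iff_mem]
    exact ⟨Submodule.mem_sup_left (Submodule.subset_span (by simp)), hα⟩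

/-- If `V` contains `α` but not `β` and meets `ℝα + ℝβ + ℝγ` in a plane, then `γ ∈ V + ℝβ`. -/
theorem mem_sup_span_singleton_of_finrank_inf [FiniteDimensional ℝ E] {V : Submodule ℝ E}
    {α β γ : E} (hα : α ∈ V) (hβ : β ∉ V)
    (hdim : Module.finrank ℝ
      ↥((Submodule.span ℝ {α} ⊔ Submodule.span ℝ {β} ⊔ Submodule.span ℝ {γ}) ⊓ V) = 2) :
    γ ∈ V ⊔ Submodule.span ℝ {β} := by
  by_contra hγ
  have h := span_pair_sup_span_singleton_inf_eq hα hβ hγ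
  rw [Submodule.span_insert, sup_right_comm] at h
  rw [h] at hdim
  have := finrank_span_le_card (R := ℝ) ({α} : Set E)
  simp at this
  omega

/-- If `V` is `2`-small, `α ∈ Φ ∩ V`, `β, γ ∈ Φ \ V` with `α, β, γ` linearly independent and
`(ℝα + ℝβ + ℝγ) ∩ V` two-dimensional, then there is a rank-2 irreducible saturated root
subsystem `Ψ ⊆ Φ` with `α ∈ Ψ`, `β, γ ∉ Ψ`, and both `(span ℝ Ψ + ℝβ) ∩ V` and
`(span ℝ Ψ + ℝγ) ∩ V` one-dimensional, hence equal to `ℝα`. -/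
theorem exists_rank_two_subsystem_avoiding_two [FiniteDimensional ℝ E]
    (Φ : Set E) (hΦ : IsRootSystem Φ)
    (V : Submodule ℝ E) (hV : V ≤ Submodule.span ℝ Φ) (hsmall : IsSmall Φ V 2)
    (α β γ : E) (hα : α ∈ Φ) (hβ : β ∈ Φ) (hγ : γ ∈ Φ)
    (hαV : α ∈ V) (hβV : β ∉ (V : Set E)) (hγV : γ ∉ (V : Set E))
    (hind : LinearIndependent ℝ ![α, β, γ])
    (hdim : Module.finrank ℝ
      ↥((Submodule.span ℝ {α} ⊔ Submodule.span ℝ {β} ⊔ Submodule.span ℝ {γ}) ⊓ V) = 2) :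
    ∃ Ψ : Set E, IsSaturatedSubsystem Φ Ψ ∧ IsIrreducibleSubsystem Ψ ∧ rootRank Ψ = 2 ∧
      α ∈ Ψ ∧ β ∉ Ψ ∧ γ ∉ Ψ ∧
      Module.finrank ℝ ↥((Submodule.span ℝ Ψ ⊔ Submodule.span ℝ {β}) ⊓ V) = 1 ∧
      Module.finrank ℝ ↥((Submodule.span ℝ Ψ ⊔ Submodule.span ℝ {γ}) ⊓ V) = 1 ∧
      (Submodule.span ℝ Ψ ⊔ Submodule.span ℝ {β}) ⊓ V = Submodule.span ℝ {α} ∧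
      (Submodule.span ℝ Ψ ⊔ Submodule.span ℝ {γ}) ⊓ V = Submodule.span ℝ {α} := by
  obtain ⟨δ, hδ, hδα, hδU⟩ := exists_inner_ne_zero_notMem_sup_span_singleton hΦ hsmall hα β
  have hδU' : δ ∉ V ⊔ Submodule.span ℝ {γ} := fun h => hδU <|
    sup_le le_sup_left ((Submodule.span_singleton_le_iff_mem _ _).2
      (mem_sup_span_singleton_of_finrank_inf hαV hβV hdim)) h
  have hspan : Submodule.span ℝ (Φ ∩ (Submodule.span ℝ {α, δ} : Submodule ℝ E)) =
      Submodule.span ℝ {α, δ} := by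
    refine le_antisymm (Submodule.span_le.2 Set.inter_subset_right) (Submodule.span_mono ?_)
    rintro x (rfl | rfl)
    · exact ⟨hα, Submodule.subset_span (by simp)⟩
    · exact ⟨hδ, Submodule.subset_span (by simp)⟩
  have hrank : Module.finrank ℝ (Submodule.span ℝ {α, δ}) = 2 := by
    have hli : LinearIndependent ℝ ![α, δ] := by
      refine (LinearIndependent.pair_iff' (hΦ.ne_zero α hα)).2 fun a ha => hδU ?_
      exact Submodule.mem_sup_left (ha ▸ V.smul_mem a hαV)
    rw [← Matrix.range_cons_cons_empty α δ ![], finrank_span_eq_card hli, Fintype.card_fin]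
  have hβ1 := span_pair_sup_span_singleton_inf_eq hαV hβV hδU
  have hγ1 := span_pair_sup_span_singleton_inf_eq hαV hγV hδU'
  have hα1 := finrank_span_singleton (K := ℝ) (hΦ.ne_zero α hα)
  refine ⟨Φ ∩ (Submodule.span ℝ {α, δ} : Submodule ℝ E), ⟨_, rfl⟩,
    isIrreducibleSubsystem_inter_span_pair hΦ hα hδ hδα, ?_,
    ⟨hα, Submodule.subset_span (by simp)⟩,
    fun h => notMem_span_pair_of_notMem_sup hαV hβV hδU h.2,
    fun h => notMem_span_pair_of_notMem_sup hαV hγV hδU' h.2, ?_⟩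
  · rw [rootRank, hspan, hrank]
  · rw [hspan, hβ1, hγ1]
    exact ⟨hα1, hα1, rfl, rfl⟩
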